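/- Let ψ_k(ν) = P_ν(λ_k) be as in the discrete Sturm–Liouville problem, let 1 ≤ m ≤ n ≤ q+1, let a_m,…,a_n be real numbers, and set V(ν) = Σ_{k=m}^{n} a_k ψ_k(ν) and V_1(ν) = Σ_{k=m}^{n} (λ_1 − λ_k) a_k ψ_k(ν) for ν ∈ [0,q]_Z. Then N(V_1) ≥ N(V), S^−(V_1) ≥ S^−(V), and S^+(V_1) ≥ S^+(V). -/

import Mathlib

namespace DiscPaper

/-- `ν` is a zero (of the first or second type) of the discrete function `f` on `[0,q]_ℤ`. -/
def IsZero (q : ℕ) (f : ℕ → ℝ) (ν : ℕ) : Prop :=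
  (ν ≤ q ∧ f ν = 0) ∨ (1 ≤ ν ∧ ν ≤ q ∧ f (ν - 1) * f ν < 0)

/-- `N q f` is the number of zeros (of both types) of `f` on `[0,q]_ℤ`. -/
noncomputable def N (q : ℕ) (f : ℕ → ℝ) : ℕ := {ν : ℕ | IsZero q f ν}.ncard

/-- `N₀ q f` is the number of zeros of the first type of `f` on `[0,q]_ℤ`. -/
noncomputable def N0 (q : ℕ) (f : ℕ → ℝ) : ℕ := {ν : ℕ | ν ≤ q ∧ f ν = 0}.ncard

/-- Number of sign changes of `g` on `[0,q]_ℤ`. -/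
noncomputable def signChanges (q : ℕ) (g : ℕ → ℝ) : ℕ :=
  {ν : ℕ | 1 ≤ ν ∧ ν ≤ q ∧ g (ν - 1) * g ν < 0}.ncard

/-- `g` is obtained from `f` by replacing all its zero values on `[0,q]_ℤ` by
arbitrary nonzero values. -/
def Admissible (q : ℕ) (f g : ℕ → ℝ) : Prop :=
  (∀ ν ≤ q, g ν ≠ 0) ∧ ∀ ν ≤ q, f ν ≠ 0 → g ν = f ν

/-- `S⁻(f)`: least number of sign changes over all admissible replacements. -/
noncomputable def Sminus (q : ℕ) (f : ℕ → ℝ) : ℕ :=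
  sInf {s | ∃ g, Admissible q f g ∧ signChanges q g = s}

/-- `S⁺(f)`: largest number of sign changes over all admissible replacements. -/
noncomputable def Splus (q : ℕ) (f : ℕ → ℝ) : ℕ :=
  sSup {s | ∃ g, Admissible q f g ∧ signChanges q g = s}
open Polynomial in
/-- STATEMENT SETUP: the polynomials `P_l` generated by the three-term recurrence
`γ_{l-1} P_{l-1} + α_l P_l + β_l P_{l+1} = λ ρ_l P_l` with `P_{-1} = 0`, `P_0 = 1`. -/
structure Recurrence (α β γ ρ : ℕ → ℝ) (P : ℕ → Polynomial ℝ) : Prop where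
  hβ : ∀ l, 0 < β l
  hγ : ∀ l, 0 < γ l
  hρ : ∀ l, 0 < ρ l
  hP0 : P 0 = 1
  hrec0 : C (α 0) * P 0 + C (β 0) * P 1 = X * (C (ρ 0) * P 0)
  hrec : ∀ l : ℕ,
    C (γ l) * P l + C (α (l + 1)) * P (l + 1) + C (β (l + 1)) * P (l + 2) =
      X * (C (ρ (l + 1)) * P (l + 1))

/-- STATEMENT SETUP: `Λ (k-1)` is the `k`-th zero `λ_k` of
`P̃_{q+1} = P_{q+1} - η P_q`, ordered decreasingly: `λ_{q+1} < ⋯ < λ_1`. -/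
structure SLZeros (P : ℕ → Polynomial ℝ) (q : ℕ) (η : ℝ) (Λ : ℕ → ℝ) : Prop where
  anti : StrictAntiOn Λ (Set.Iic q)
  root : ∀ i ≤ q, (P (q + 1) - Polynomial.C η * P q).eval (Λ i) = 0


/-! ### Counting functions: recursion in `q` -/

lemma N_zero (f : ℕ → ℝ) : N 0 f = if f 0 = 0 then 1 else 0 := by
  unfold N IsZero
  split_ifs with h
  · have : {ν : ℕ | (ν ≤ 0 ∧ f ν = 0) ∨ (1 ≤ ν ∧ ν ≤ 0 ∧ f (ν - 1) * f ν < 0)} = {0} := by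
      ext ν
      simp only [Set.mem_ofPred_eq, Set.mem_singleton_iff]
      constructor
      · rintro (h | h) <;> omega
      · rintro rfl
        exact Or.inl ⟨le_rfl, h⟩
    rw [this, Set.ncard_singleton]
  · have : {ν : ℕ | (ν ≤ 0 ∧ f ν = 0) ∨ (1 ≤ ν ∧ ν ≤ 0 ∧ f (ν - 1) * f ν < 0)} = ∅ := by
      ext ν
      simp only [Set.mem_ofPred_eq, Set.mem_empty_iff_false, iff_false]
      rintro (⟨h1, h2⟩ | h1)
      · obtain rfl : ν = 0 := by omega
        exact h h2
      · omega
    rw [this, Set.ncard_empty]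

lemma N_succ (q : ℕ) (f : ℕ → ℝ) :
    N (q + 1) f = N q f + if f (q + 1) = 0 ∨ f q * f (q + 1) < 0 then 1 else 0 := by
  have hfin : {ν : ℕ | IsZero q f ν}.Finite := by
    apply (Set.finite_Iic q).subset
    rintro ν (h | h)
    · exact h.1
    · exact h.2.1
  have hnot : q + 1 ∉ {ν : ℕ | IsZero q f ν} := by
    rintro (h | h) <;> omega
  unfold N
  split_ifs with h
  · have : {ν : ℕ | IsZero (q + 1) f ν} = insert (q + 1) {ν : ℕ | IsZero q f ν} := by
      ext ν
      simp only [Set.mem_ofPred_eq, Set.mem_insert_iff, IsZero]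
      by_cases hν : ν = q + 1
      · subst hν
        simpa using h
      · have : ν ≤ q + 1 ↔ ν ≤ q := by omega
        simp [hν, this]
    rw [this, Set.ncard_insert_of_notMem hnot hfin]
  · have : {ν : ℕ | IsZero (q + 1) f ν} = {ν : ℕ | IsZero q f ν} := by
      ext ν
      simp only [Set.mem_ofPred_eq, IsZero]
      by_cases hν : ν = q + 1
      · subst hν
        simpa using h
      · have : ν ≤ q + 1 ↔ ν ≤ q := by omega
        simp [this]
    rw [this, add_zero]

lemma sc_zero (f : ℕ → ℝ) : signChanges 0 f = 0 := by
  unfold signChanges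
  have : {ν : ℕ | 1 ≤ ν ∧ ν ≤ 0 ∧ f (ν - 1) * f ν < 0} = ∅ := by
    ext ν
    simp only [Set.mem_ofPred_eq, Set.mem_empty_iff_false, iff_false]
    omega
  rw [this, Set.ncard_empty]

lemma sc_finite (q : ℕ) (f : ℕ → ℝ) :
    {ν : ℕ | 1 ≤ ν ∧ ν ≤ q ∧ f (ν - 1) * f ν < 0}.Finite :=
  (Set.finite_Iic q).subset fun _ h => h.2.1

lemma sc_succ (q : ℕ) (f : ℕ → ℝ) :
    signChanges (q + 1) f = signChanges q f + if f q * f (q + 1) < 0 then 1 else 0 := by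
  have hnot : q + 1 ∉ {ν : ℕ | 1 ≤ ν ∧ ν ≤ q ∧ f (ν - 1) * f ν < 0} := by
    rintro h
    have := h.2.1
    omega
  unfold signChanges
  split_ifs with h
  · have : {ν : ℕ | 1 ≤ ν ∧ ν ≤ q + 1 ∧ f (ν - 1) * f ν < 0} =
        insert (q + 1) {ν : ℕ | 1 ≤ ν ∧ ν ≤ q ∧ f (ν - 1) * f ν < 0} := by
      ext ν
      simp only [Set.mem_ofPred_eq, Set.mem_insert_iff]
      by_cases hν : ν = q + 1
      · subst hν
        simpa using h
      · have : ν ≤ q + 1 ↔ ν ≤ q := by omega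
        simp [hν, this]
    rw [this, Set.ncard_insert_of_notMem hnot (sc_finite q f)]
  · have : {ν : ℕ | 1 ≤ ν ∧ ν ≤ q + 1 ∧ f (ν - 1) * f ν < 0} =
        {ν : ℕ | 1 ≤ ν ∧ ν ≤ q ∧ f (ν - 1) * f ν < 0} := by
      ext ν
      simp only [Set.mem_ofPred_eq]
      by_cases hν : ν = q + 1
      · subst hν
        simpa using h
      · have : ν ≤ q + 1 ↔ ν ≤ q := by omega
        simp [this]
    rw [this, add_zero]

lemma sc_le (q : ℕ) (f : ℕ → ℝ) : signChanges q f ≤ q := by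
  induction q with
  | zero => rw [sc_zero]
  | succ q ih =>
    rw [sc_succ]
    split_ifs <;> omega

lemma sc_congr (q : ℕ) (f g : ℕ → ℝ) (h : ∀ l ≤ q, 0 < f l * g l) :
    signChanges q f = signChanges q g := by
  unfold signChanges
  congr 1
  ext ν
  simp only [Set.mem_ofPred_eq]
  refine and_congr_right fun h1 => and_congr_right fun h2 => ?_
  have a := h ν h2
  have b := h (ν - 1) (by omega)
  have e : (f (ν - 1) * f ν) * (g (ν - 1) * g ν) = (f (ν - 1) * g (ν - 1)) * (f ν * g ν) := by ring
  have e' := mul_pos b a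
  rw [← e] at e'
  constructor
  · intro h
    by_contra! h'
    nlinarith [mul_nonneg (neg_nonneg.2 h.le) h']
  · intro h
    by_contra! h'
    nlinarith [mul_nonneg (neg_nonneg.2 h.le) h']

/-! ### The sign automaton for `N` -/

/-- potential of the automaton counting zeros -/
def phiN (w d t : SignType) : ℤ :=
  if w = 0 then (if (d = -1 ∧ t = -1) ∨ (d = 1 ∧ t = 1) then -1 else 0)
  else if d * w = -1 then (if t * w = -1 then -1 else 0)
  else (if t * w = 1 then 0 else 1)

/-- cost of one step -/
def zc (a b : SignType) : ℤ := if b = 0 ∨ a * b = -1 then 1 else 0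

/-- admissible evolution of the sign of `V` -/
def okW (w d w' : SignType) : Prop :=
  (d = 0 → w' = w) ∧ (d ≠ 0 → w * d ≠ 1 → w' = -d)

/-- admissible evolution of the difference sign -/
def okT (d d' t : SignType) : Prop :=
  (d < d' → t = 1) ∧ (d' < d → t = -1) ∧ (d = 0 → d' = 0 → t = 0)

instance (w d w' : SignType) : Decidable (okW w d w') := by unfold okW; infer_instance
instance (w d w' : SignType) : Decidable (okT w d w') := by unfold okT; infer_instance

lemma phiN_step : ∀ w d t w' d' t' : SignType, okW w d w' → okT d d' t' →
    phiN w' d' t' ≤ phiN w d t + zc t t' - zc w w' := by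
  decide +kernel

lemma phiN_init : ∀ w d : SignType,
    phiN w d d ≤ (if d = 0 then 1 else 0) - (if w = 0 then 1 else 0) := by decide

lemma phiN_final : ∀ w t : SignType, 0 ≤ phiN w 0 t := by decide

/-- potential of the automaton for `S⁻` -/
def phiS (s d t : SignType) : ℤ :=
  if d * s = -1 then (if t * s = -1 then -1 else 0)
  else if d = 0 then 0
  else (if t * s = -1 then 1 else 0)

/-- admissible evolution for `G` -/
def okG (d d' t : SignType) : Prop :=
  t ≠ 0 ∧ (d < d' → t = 1) ∧ (d' < d → t = -1)

instance (w d w' : SignType) : Decidable (okG w d w') := by unfold okG; infer_instance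

lemma phiS_step : ∀ w d t w' d' t' : SignType, w ≠ 0 → w' ≠ 0 → t ≠ 0 → (w' ≠ w → d = w) →
    okG d d' t' → phiS w' d' t' ≤ phiS w d t + zc t t' - zc w w' := by
  decide +kernel

lemma phiS_init : ∀ w d t : SignType, w ≠ 0 → okG 0 d t → phiS w d t ≤ 0 := by decide

lemma phiS_final : ∀ w t : SignType, w ≠ 0 → 0 ≤ phiS w 0 t := by decide

/-! ### The difference operator -/

/-- the flux -/
noncomputable def Dd (p r : ℕ → ℝ) (q : ℕ) (V : ℕ → ℝ) (l : ℕ) : ℝ :=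
  if l < q then p l * V l - r l * V (l + 1) else 0

/-- the operator -/
noncomputable def Ld (k p r : ℕ → ℝ) (q : ℕ) (V : ℕ → ℝ) : ℕ → ℝ
  | 0 => Dd p r q V 0 / k 0
  | l + 1 => (Dd p r q V (l + 1) - Dd p r q V l) / k (l + 1)

open SignType in
lemma okT_real (x y t k : ℝ) (hk : 0 < k) (h : t = (y - x) / k) :
    okT (sign x) (sign y) (sign t) := by
  have key : ∀ a b : ℝ, sign a < sign b → a < b := by
    intro a b hab
    by_contra! hle
    exact absurd (sign.monotone hle) (not_le.2 hab)
  refine ⟨fun hh => ?_, fun hh => ?_, fun h1 h2 => ?_⟩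
  · exact sign_pos (h ▸ div_pos (sub_pos.2 (key _ _ hh)) hk)
  · exact sign_neg (h ▸ div_neg_of_neg_of_pos (sub_neg.2 (key _ _ hh)) hk)
  · rw [sign_eq_zero_iff] at h1 h2 ⊢
    rw [h, h1, h2]; simp

open SignType in
lemma okW_real (p r x y d : ℝ) (hp : 0 < p) (hr : 0 < r) (e : d = p * x - r * y) :
    okW (sign x) (sign d) (sign y) := by
  have hx : (sign x = 1 ∧ 0 < p * x) ∨ (sign x = 0 ∧ p * x = 0) ∨ (sign x = -1 ∧ p * x < 0) := by
    rcases lt_trichotomy x 0 with hx | hx | hx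
    · exact Or.inr (Or.inr ⟨sign_neg hx, mul_neg_of_pos_of_neg hp hx⟩)
    · exact Or.inr (Or.inl (by simp [hx]))
    · exact Or.inl ⟨sign_pos hx, mul_pos hp hx⟩
  have hy : (sign y = 1 ∧ 0 < r * y) ∨ (sign y = 0 ∧ r * y = 0) ∨ (sign y = -1 ∧ r * y < 0) := by
    rcases lt_trichotomy y 0 with hx | hx | hx
    · exact Or.inr (Or.inr ⟨sign_neg hx, mul_neg_of_pos_of_neg hr hx⟩)
    · exact Or.inr (Or.inl (by simp [hx]))
    · exact Or.inl ⟨sign_pos hx, mul_pos hr hx⟩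
  have hd : (sign d = 1 ∧ 0 < d) ∨ (sign d = 0 ∧ d = 0) ∨ (sign d = -1 ∧ d < 0) := by
    rcases lt_trichotomy d 0 with hx | hx | hx
    · exact Or.inr (Or.inr ⟨sign_neg hx, hx⟩)
    · exact Or.inr (Or.inl (by simp [hx]))
    · exact Or.inl ⟨sign_pos hx, hx⟩
  rcases hx with ⟨h1, h2⟩ | ⟨h1, h2⟩ | ⟨h1, h2⟩ <;>
  rcases hy with ⟨h3, h4⟩ | ⟨h3, h4⟩ | ⟨h3, h4⟩ <;>
  rcases hd with ⟨h5, h6⟩ | ⟨h5, h6⟩ | ⟨h5, h6⟩ <;>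
  rw [h1, h3, h5] <;>
  first
    | decide
    | (exfalso; linarith)

open SignType in
lemma sign_mul_lt (a b : ℝ) : a * b < 0 ↔ sign a * sign b = -1 := by
  rw [← sign_mul, sign_eq_neg_one_iff]

open SignType in
lemma zc_real (a b : ℝ) : ((if b = 0 ∨ a * b < 0 then 1 else 0 : ℕ) : ℤ) =
    zc (sign a) (sign b) := by
  unfold zc
  simp only [sign_eq_zero_iff, ← sign_mul_lt]
  split_ifs <;> rfl

open SignType in
lemma zc_real' (a b : ℝ) (hb : b ≠ 0) : ((if a * b < 0 then 1 else 0 : ℕ) : ℤ) =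
    zc (sign a) (sign b) := by
  rw [← zc_real]
  simp [hb]

section ops
variable {k p r : ℕ → ℝ} {q : ℕ}

open SignType in
lemma N_aux (hk : ∀ l, 0 < k l) (hp : ∀ l < q, 0 < p l) (hr : ∀ l < q, 0 < r l) (V : ℕ → ℝ) :
    ∀ l ≤ q, phiN (sign (V l)) (sign (Dd p r q V l)) (sign (Ld k p r q V l)) ≤
      (N l (Ld k p r q V) : ℤ) - N l V := by
  intro l
  induction l with
  | zero =>
    intro _
    have : sign (Ld k p r q V 0) = sign (Dd p r q V 0) := by
      simp only [Ld, div_eq_mul_inv, sign_mul, sign_pos (inv_pos.2 (hk 0)), mul_one]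
    have h0 := phiN_init (sign (V 0)) (sign (Dd p r q V 0))
    rw [← this] at h0
    rw [N_zero, N_zero, ← this]
    simp only [sign_eq_zero_iff] at h0
    push_cast
    exact h0
  | succ l ih =>
    intro hl
    have ih := ih (by omega)
    have e : Dd p r q V l = p l * V l - r l * V (l + 1) := by
      simp [Dd, show l < q by omega]
    have h1 := okW_real (p l) (r l) (V l) (V (l + 1)) _ (hp l (by omega)) (hr l (by omega)) e
    have h2 := okT_real (Dd p r q V l) (Dd p r q V (l + 1)) (Ld k p r q V (l + 1)) (k (l + 1))
      (hk _) rfl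
    have h3 := phiN_step _ _ (sign (Ld k p r q V l)) _ _ _ h1 h2
    rw [N_succ, N_succ, Nat.cast_add, Nat.cast_add, zc_real, zc_real]
    linarith

lemma N_op (hk : ∀ l, 0 < k l) (hp : ∀ l < q, 0 < p l) (hr : ∀ l < q, 0 < r l) (V : ℕ → ℝ) :
    N q V ≤ N q (Ld k p r q V) := by
  have h := N_aux hk hp hr V q le_rfl
  have e : Dd p r q V q = 0 := by simp [Dd]
  rw [e, sign_zero] at h
  have := phiN_final (SignType.sign (V q)) (SignType.sign (Ld k p r q V q))
  omega

/-- fill zero values with the previous value -/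
noncomputable def gfill (V : ℕ → ℝ) : ℕ → ℝ
  | 0 => if V 0 = 0 then 1 else V 0
  | l + 1 => if V (l + 1) = 0 then gfill V l else V (l + 1)

lemma gfill_ne (V : ℕ → ℝ) (l : ℕ) : gfill V l ≠ 0 := by
  induction l with
  | zero => unfold gfill; split_ifs with h <;> simp [h]
  | succ l ih => unfold gfill; split_ifs with h <;> assumption

lemma gfill_eq (V : ℕ → ℝ) (l : ℕ) (h : V l ≠ 0) : gfill V l = V l := by
  cases l <;> simp [gfill, h]

lemma gfill_adm (q : ℕ) (V : ℕ → ℝ) : Admissible q V (gfill V) :=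
  ⟨fun l _ => gfill_ne V l, fun l _ => gfill_eq V l⟩

open SignType in
lemma okG_real (x y t k g : ℝ) (hk : 0 < k) (h : t = (y - x) / k) (hg : g ≠ 0)
    (ht : t ≠ 0 → g = t) : okG (sign x) (sign y) (sign g) := by
  obtain ⟨h1, h2, -⟩ := okT_real x y t k hk h
  refine ⟨by simpa using hg, fun hh => ?_, fun hh => ?_⟩
  · have := h1 hh
    rw [ht, this]
    intro h0
    simp [h0] at this
  · have := h2 hh
    rw [ht, this]
    intro h0
    simp [h0] at this

open SignType in
lemma S_change (p r : ℝ) (hp : 0 < p) (hr : 0 < r) (V : ℕ → ℝ) (l : ℕ)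
    (h : sign (gfill V (l + 1)) ≠ sign (gfill V l)) :
    sign (p * V l - r * V (l + 1)) = sign (gfill V l) := by
  have hV : V (l + 1) ≠ 0 := by
    intro h0
    apply h
    simp [gfill, h0]
  rw [gfill_eq V (l + 1) hV] at h
  have hgl : V l = 0 ∨ gfill V l = V l := by
    by_cases h0 : V l = 0
    · exact Or.inl h0
    · exact Or.inr (gfill_eq V l h0)
  have hne := gfill_ne V l
  rcases lt_or_gt_of_ne hne with h1 | h1
  · have h2 : V l ≤ 0 := by rcases hgl with h | h <;> linarith
    have h3 : 0 < V (l + 1) := by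
      rcases lt_or_gt_of_ne hV with h3 | h3
      · exact absurd (by rw [sign_neg h3, sign_neg h1]) h
      · exact h3
    rw [sign_neg h1, sign_eq_neg_one_iff]
    nlinarith [mul_pos hr h3]
  · have h2 : 0 ≤ V l := by rcases hgl with h | h <;> linarith
    have h3 : V (l + 1) < 0 := by
      rcases lt_or_gt_of_ne hV with h3 | h3
      · exact h3
      · exact absurd (by rw [sign_pos h3, sign_pos h1]) h
    rw [sign_pos h1, sign_eq_one_iff]
    nlinarith [mul_pos hr (neg_pos.2 h3)]

open SignType in
lemma S_aux (hk : ∀ l, 0 < k l) (hp : ∀ l < q, 0 < p l) (hr : ∀ l < q, 0 < r l) (V G : ℕ → ℝ)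
    (hG : Admissible q (Ld k p r q V) G) :
    ∀ l ≤ q, phiS (sign (gfill V l)) (sign (Dd p r q V l)) (sign (G l)) ≤
      (signChanges l G : ℤ) - signChanges l (gfill V) := by
  intro l
  induction l with
  | zero =>
    intro _
    rw [sc_zero, sc_zero]
    have h := okG_real 0 (Dd p r q V 0) (Ld k p r q V 0) (k 0) (G 0) (hk 0) (by simp [Ld])
      (hG.1 0 (by omega)) (hG.2 0 (by omega))
    rw [sign_zero] at h
    simpa using phiS_init (sign (gfill V 0)) _ _ (by simpa using gfill_ne V 0) h
  | succ l ih =>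
    intro hl
    have ih := ih (by omega)
    have e : Dd p r q V l = p l * V l - r l * V (l + 1) := by
      simp [Dd, show l < q by omega]
    have h1 := S_change (p l) (r l) (hp l (by omega)) (hr l (by omega)) V l
    rw [← e] at h1
    have h2 := okG_real (Dd p r q V l) (Dd p r q V (l + 1)) (Ld k p r q V (l + 1)) (k (l + 1))
      (G (l + 1)) (hk _) rfl (hG.1 _ hl) (hG.2 _ hl)
    have h3 := phiS_step _ _ (sign (G l)) _ _ _ (by simpa using gfill_ne V l)
      (by simpa using gfill_ne V (l + 1)) (by simpa using hG.1 l (by omega)) h1 h2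
    rw [sc_succ, sc_succ, Nat.cast_add, Nat.cast_add, zc_real' _ _ (gfill_ne V (l + 1)),
      zc_real' _ _ (hG.1 _ hl)]
    linarith

lemma S_op (hk : ∀ l, 0 < k l) (hp : ∀ l < q, 0 < p l) (hr : ∀ l < q, 0 < r l) (V G : ℕ → ℝ)
    (hG : Admissible q (Ld k p r q V) G) :
    signChanges q (gfill V) ≤ signChanges q G := by
  have h := S_aux hk hp hr V G hG q le_rfl
  have e : Dd p r q V q = 0 := by simp [Dd]
  rw [e, sign_zero] at h
  have := phiS_final (SignType.sign (gfill V q)) (SignType.sign (G q))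
    (by simpa using gfill_ne V q)
  omega

lemma Sminus_op (hk : ∀ l, 0 < k l) (hp : ∀ l < q, 0 < p l) (hr : ∀ l < q, 0 < r l)
    (V : ℕ → ℝ) : Sminus q V ≤ Sminus q (Ld k p r q V) := by
  have hne : {s | ∃ g, Admissible q (Ld k p r q V) g ∧ signChanges q g = s}.Nonempty :=
    ⟨_, gfill _, gfill_adm _ _, rfl⟩
  obtain ⟨G, hG, hs⟩ := Nat.sInf_mem hne
  have h1 : Sminus q V ≤ signChanges q (gfill V) := Nat.sInf_le ⟨_, gfill_adm _ _, rfl⟩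
  have h2 := S_op hk hp hr V G hG
  unfold Sminus at h1 ⊢
  omega

lemma Ld_add (V h : ℕ → ℝ) (ε : ℝ) (l : ℕ) :
    Ld k p r q (fun l => V l + ε * h l) l = Ld k p r q V l + ε * Ld k p r q h l := by
  have hD : ∀ l, Dd p r q (fun l => V l + ε * h l) l = Dd p r q V l + ε * Dd p r q h l := by
    intro l
    unfold Dd
    split_ifs <;> ring
  cases l with
  | zero => simp only [Ld, hD]; ring
  | succ l => simp only [Ld, hD]; ring

open Filter Topology in
lemma small_eps (a b : ℝ) (ha : a ≠ 0) : ∀ᶠ ε in 𝓝[>] (0 : ℝ), 0 < a * (a + ε * b) := by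
  have hc : Continuous fun ε : ℝ => a * (a + ε * b) := by fun_prop
  have h0 : (0 : ℝ) < a * (a + 0 * b) := by
    have := mul_self_pos.2 ha
    simpa using this
  exact ((hc.tendsto 0).eventually (lt_mem_nhds h0)).filter_mono nhdsWithin_le_nhds

open Filter Topology in
lemma Splus_op (hk : ∀ l, 0 < k l) (hp : ∀ l < q, 0 < p l) (hr : ∀ l < q, 0 < r l)
    (V : ℕ → ℝ) : Splus q V ≤ Splus q (Ld k p r q V) := by
  have hbdd : ∀ f : ℕ → ℝ, BddAbove {s | ∃ g, Admissible q f g ∧ signChanges q g = s} := by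
    intro f
    refine ⟨q, ?_⟩
    rintro s ⟨g, -, rfl⟩
    exact sc_le q g
  have hne : {s | ∃ g, Admissible q V g ∧ signChanges q g = s}.Nonempty :=
    ⟨_, gfill _, gfill_adm _ _, rfl⟩
  obtain ⟨g, hg, hs⟩ := Nat.sSup_mem hne (hbdd V)
  -- perturbation direction
  let h : ℕ → ℝ := fun l => if V l = 0 then g l else 0
  have hev : ∀ᶠ ε in 𝓝[>] (0 : ℝ), ∀ l ∈ Finset.range (q + 1),
      (Ld k p r q V l ≠ 0 → 0 < Ld k p r q V l * (Ld k p r q V l + ε * Ld k p r q h l)) := by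
    rw [Filter.eventually_all_finset]
    intro l _
    by_cases h0 : Ld k p r q V l = 0
    · exact Eventually.of_forall fun ε hh => absurd h0 hh
    · filter_upwards [small_eps (Ld k p r q V l) (Ld k p r q h l) h0] with ε hε _ using hε
  obtain ⟨ε, hε, hεpos⟩ := (hev.and self_mem_nhdsWithin).exists
  have hεpos : 0 < ε := hεpos
  let U : ℕ → ℝ := fun l => V l + ε * h l
  have hU : ∀ l ≤ q, 0 < U l * g l := by
    intro l hl
    have hgl := hg.1 l hl
    by_cases h0 : V l = 0
    · simp only [U, h, h0, if_true, zero_add]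
      rw [mul_assoc]
      exact mul_pos hεpos (mul_self_pos.2 hgl)
    · simp only [U, h, h0, if_false, mul_zero, add_zero, hg.2 l hl h0]
      exact mul_self_pos.2 h0
  have hUg : signChanges q (gfill U) = signChanges q g := by
    apply sc_congr
    intro l hl
    have := hU l hl
    rw [gfill_eq]
    · exact this
    · intro h0
      simp [h0] at this
  let G : ℕ → ℝ := gfill (Ld k p r q U)
  have h1 : signChanges q (gfill U) ≤ signChanges q G :=
    S_op hk hp hr U G (gfill_adm _ _)
  let G' : ℕ → ℝ := fun l => if Ld k p r q V l = 0 then G l else Ld k p r q V l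
  have hGG : signChanges q G = signChanges q G' := by
    apply sc_congr
    intro l hl
    by_cases h0 : Ld k p r q V l = 0
    · simp only [G', h0, if_true]
      exact mul_self_pos.2 (gfill_ne _ _)
    · simp only [G', h0, if_false]
      have h2 := hε l (Finset.mem_range.2 (by omega)) h0
      rw [← Ld_add] at h2
      have h3 : G l = Ld k p r q U l := by
        apply gfill_eq
        intro h4
        change 0 < _ * Ld k p r q U l at h2
        simp [h4] at h2
      rw [h3, mul_comm]
      exact h2
  have hadm : Admissible q (Ld k p r q V) G' := by
    refine ⟨fun l _ => ?_, fun l _ h0 => by simp [G', h0]⟩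
    by_cases h0 : Ld k p r q V l = 0
    · simp only [G', h0, if_true]
      exact gfill_ne _ _
    · simp only [G', h0, if_false]
      exact h0
  have h2 : signChanges q G' ≤ Splus q (Ld k p r q V) := le_csSup (hbdd _) ⟨G', hadm, rfl⟩
  unfold Splus at h2 ⊢
  omega

end ops

/-! ### Positivity of `ψ₁` -/

section pos
variable {α β γ ρ : ℕ → ℝ} {P : ℕ → Polynomial ℝ}

lemma rec0 (hP : Recurrence α β γ ρ P) (x : ℝ) :
    α 0 * (P 0).eval x + β 0 * (P 1).eval x = x * (ρ 0 * (P 0).eval x) := by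
  simpa using congrArg (Polynomial.eval x) hP.hrec0

lemma recS (hP : Recurrence α β γ ρ P) (l : ℕ) (x : ℝ) :
    γ l * (P l).eval x + α (l + 1) * (P (l + 1)).eval x + β (l + 1) * (P (l + 2)).eval x =
      x * (ρ (l + 1) * (P (l + 1)).eval x) := by
  simpa using congrArg (Polynomial.eval x) (hP.hrec l)

open Filter in
lemma ev_pos (hP : Recurrence α β γ ρ P) (l : ℕ) :
    ∀ K : ℝ, ∀ᶠ x in atTop, 0 < (P l).eval x ∧ K * (P l).eval x < (P (l + 1)).eval x := by
  induction l with
  | zero =>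
    intro K
    filter_upwards [eventually_gt_atTop ((β 0 * K + α 0) / ρ 0)] with x hx
    have h := rec0 hP x
    have hb := hP.hβ 0
    rw [div_lt_iff₀ (hP.hρ 0)] at hx
    rw [hP.hP0] at h ⊢
    simp only [Polynomial.eval_one, mul_one] at h ⊢
    refine ⟨one_pos, ?_⟩
    simp only [zero_add]
    by_contra! hc
    nlinarith
  | succ l ih =>
    intro K
    filter_upwards [ih 1, eventually_gt_atTop ((β (l + 1) * K + α (l + 1) + γ l) / ρ (l + 1))]
      with x hx hx2
    have h := recS hP l x
    have hb := hP.hβ (l + 1)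
    have hg := hP.hγ l
    rw [div_lt_iff₀ (hP.hρ (l + 1))] at hx2
    obtain ⟨h1, h2⟩ := hx
    rw [one_mul] at h2
    have h3 : 0 < (P (l + 1)).eval x := h1.trans h2
    refine ⟨h3, ?_⟩
    have h4 := mul_lt_mul_of_pos_right hx2 h3
    have h5 := mul_lt_mul_of_pos_left h2 hg
    by_contra! hc
    have h6 := mul_le_mul_of_nonneg_left hc hb.le
    nlinarith

lemma deg_le (hP : Recurrence α β γ ρ P) (l : ℕ) :
    (P l).natDegree ≤ l ∧ (P (l + 1)).natDegree ≤ l + 1 := by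
  have key : ∀ (b : ℝ) (A B : Polynomial ℝ) (n : ℕ), 0 < b → Polynomial.C b * A = B →
      B.natDegree ≤ n → A.natDegree ≤ n := by
    intro b A B n hb h hB
    rw [← h, Polynomial.natDegree_C_mul hb.ne'] at hB
    exact hB
  induction l with
  | zero =>
    refine ⟨by simp [hP.hP0], ?_⟩
    apply key (β 0) _ _ _ (hP.hβ 0) (eq_sub_of_add_eq' hP.hrec0)
    rw [hP.hP0]
    compute_degree
  | succ l ih =>
    obtain ⟨h1, h2⟩ := ih
    refine ⟨h2, ?_⟩
    apply key (β (l + 1)) _ _ _ (hP.hβ _) (eq_sub_of_add_eq' (hP.hrec l))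
    refine (Polynomial.natDegree_sub_le _ _).trans (max_le ?_ ?_)
    · refine Polynomial.natDegree_mul_le.trans ?_
      have := (Polynomial.natDegree_C_mul_le (ρ (l + 1)) (P (l + 1)))
      have := Polynomial.natDegree_X_le (R := ℝ)
      omega
    · refine (Polynomial.natDegree_add_le _ _).trans (max_le ?_ ?_)
      · exact (Polynomial.natDegree_C_mul_le _ _).trans (by omega)
      · exact (Polynomial.natDegree_C_mul_le _ _).trans (by omega)

open Filter in
lemma Ptilde_nonneg (hP : Recurrence α β γ ρ P) {q : ℕ} {η : ℝ} {Λ : ℕ → ℝ}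
    (hΛ : SLZeros P q η Λ) (y : ℝ) (hy : Λ 0 ≤ y) :
    0 ≤ (P (q + 1) - Polynomial.C η * P q).eval y := by
  set Q := P (q + 1) - Polynomial.C η * P q with hQ
  by_contra! hneg
  obtain ⟨b, ⟨hb1, hb2⟩, hb3⟩ := ((ev_pos hP q η).and (eventually_ge_atTop y)).exists
  have hQb : 0 < Q.eval b := by
    rw [hQ]
    simp only [Polynomial.eval_sub, Polynomial.eval_mul, Polynomial.eval_C]
    linarith
  obtain ⟨z, hz, hz0⟩ : ∃ z ∈ Set.Icc y b, Q.eval z = 0 := by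
    have := intermediate_value_Icc hb3 (Q.continuous.continuousOn (s := Set.Icc y b))
    exact this ⟨hneg.le, hQb.le⟩
  have hyz : y < z := by
    rcases hz.1.lt_or_eq with h | h
    · exact h
    · rw [h] at hneg
      exact absurd hz0 hneg.ne
  have hle : ∀ i ≤ q, Λ i ≤ Λ 0 := fun i hi =>
    hΛ.anti.antitoneOn (Set.mem_Iic.2 (Nat.zero_le q)) (Set.mem_Iic.2 hi) (Nat.zero_le i)
  have hcard : ((Finset.range (q + 1)).image Λ).card = q + 1 := by
    rw [Finset.card_image_of_injOn, Finset.card_range]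
    intro i hi j hj hij
    have hi' : i ≤ q := by have := Finset.mem_range.1 hi; omega
    have hj' : j ≤ q := by have := Finset.mem_range.1 hj; omega
    exact hΛ.anti.injOn hi' hj' hij
  have hzn : z ∉ (Finset.range (q + 1)).image Λ := by
    intro h
    obtain ⟨i, hi, rfl⟩ := Finset.mem_image.1 h
    have := hle i (by have := Finset.mem_range.1 hi; omega)
    linarith
  have hzero : Q = 0 := by
    apply Polynomial.eq_zero_of_natDegree_lt_card_of_eval_eq_zero' Q
      (insert z ((Finset.range (q + 1)).image Λ))
    · intro i hi
      rcases Finset.mem_insert.1 hi with rfl | hi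
      · exact hz0
      · obtain ⟨j, hj, rfl⟩ := Finset.mem_image.1 hi
        exact hΛ.root j (by have := Finset.mem_range.1 hj; omega)
    · rw [Finset.card_insert_of_notMem hzn, hcard]
      have h1 : Q.natDegree ≤ q + 1 := by
        refine (Polynomial.natDegree_sub_le _ _).trans (max_le (deg_le hP q).2 ?_)
        exact (Polynomial.natDegree_C_mul_le _ _).trans ((deg_le hP q).1.trans (by omega))
      omega
  rw [hzero] at hQb
  simp at hQb

lemma no_double (hP : Recurrence α β γ ρ P) (y : ℝ) (l : ℕ) :
    ¬ ((P l).eval y = 0 ∧ (P (l + 1)).eval y = 0) := by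
  induction l with
  | zero =>
    rintro ⟨h, -⟩
    simp [hP.hP0] at h
  | succ l ih =>
    rintro ⟨h1, h2⟩
    have h := recS hP l y
    rw [h1, h2] at h
    have hg := hP.hγ l
    apply ih
    refine ⟨?_, h1⟩
    have : γ l * (P l).eval y = 0 := by linarith
    exact (mul_eq_zero.1 this).resolve_left hg.ne'

open Filter in
lemma psi_pos (hP : Recurrence α β γ ρ P) {q : ℕ} {η : ℝ} {Λ : ℕ → ℝ}
    (hΛ : SLZeros P q η Λ) : ∀ ν ≤ q, 0 < (P ν).eval (Λ 0) := by
  by_contra! hcon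
  obtain ⟨ν₀, hν₀, hneg⟩ := hcon
  let S : Set ℝ := {x | Λ 0 ≤ x ∧ ∃ ν ∈ Finset.range (q + 1), (P ν).eval x ≤ 0}
  have hSeq : S = Set.Ici (Λ 0) ∩ ⋃ ν ∈ Finset.range (q + 1), {x | (P ν).eval x ≤ 0} := by
    ext x
    simp [S]
  have hclosed : IsClosed S := by
    rw [hSeq]
    refine isClosed_Ici.inter ?_
    apply Set.Finite.isClosed_biUnion (Finset.finite_toSet _)
    intro ν _
    exact isClosed_le (P ν).continuous continuous_const
  have hne : S.Nonempty := ⟨Λ 0, le_rfl, ν₀, Finset.mem_range.2 (by omega), hneg⟩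
  have hbdd : BddAbove S := by
    have hev : ∀ᶠ x in atTop, ∀ ν ∈ Finset.range (q + 1), 0 < (P ν).eval x := by
      rw [Filter.eventually_all_finset]
      intro ν _
      exact (ev_pos hP ν 0).mono fun x hx => hx.1
    obtain ⟨b, hb⟩ := eventually_atTop.1 hev
    refine ⟨b, ?_⟩
    rintro x ⟨-, ν, hν, hx⟩
    by_contra! hlt
    exact absurd (hb x hlt.le ν hν) (not_lt.2 hx)
  obtain ⟨hy1, ν, hν, hy2⟩ := hclosed.csSup_mem hne hbdd
  set y := sSup S with hy
  have hνq : ν ≤ q := by have := Finset.mem_range.1 hν; omega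
  -- all values at `y` are nonnegative
  have hnn : ∀ μ ≤ q, 0 ≤ (P μ).eval y := by
    intro μ hμ
    by_contra! hlt
    have h1 : ∀ᶠ x in nhds y, (P μ).eval x < 0 :=
      ((P μ).continuous.tendsto y).eventually (gt_mem_nhds hlt)
    have h2 : ∀ᶠ x in nhdsWithin y (Set.Ioi y), (P μ).eval x < 0 :=
      h1.filter_mono nhdsWithin_le_nhds
    obtain ⟨x, hx1, hx2⟩ := (h2.and self_mem_nhdsWithin).exists
    have hx2 : y < x := hx2
    have : x ∈ S := ⟨hy1.trans hx2.le, μ, Finset.mem_range.2 (by omega), hx1.le⟩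
    exact absurd (le_csSup hbdd this) (not_le.2 hx2)
  have hν0 : (P ν).eval y = 0 := le_antisymm hy2 (hnn ν hνq)
  cases ν with
  | zero => simp [hP.hP0] at hν0
  | succ l =>
    have hnext : 0 ≤ (P (l + 2)).eval y := by
      by_cases hl : l + 2 ≤ q
      · exact hnn _ hl
      · have hq : q = l + 1 := by omega
        have := Ptilde_nonneg hP hΛ y hy1
        rw [hq] at this
        simpa [hν0] using this
    have h := recS hP l y
    rw [hν0] at h
    have hg := hP.hγ l
    have hb := hP.hβ (l + 1)
    have h1 := mul_nonneg hb.le hnext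
    have h2 := mul_nonneg hg.le (hnn l (by omega))
    have h3 : γ l * (P l).eval y = 0 := by linarith
    exact no_double hP y l ⟨(mul_eq_zero.1 h3).resolve_left hg.ne', hν0⟩

end pos

/-- symmetrizing weights -/
noncomputable def wt (β γ : ℕ → ℝ) : ℕ → ℝ
  | 0 => 1
  | l + 1 => wt β γ l * β l / γ l

lemma wt_pos {β γ : ℕ → ℝ} (hβ : ∀ l, 0 < β l) (hγ : ∀ l, 0 < γ l) (l : ℕ) : 0 < wt β γ l := by
  induction l with
  | zero => simp [wt]
  | succ l ih => exact div_pos (mul_pos ih (hβ l)) (hγ l)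

/-- for `1 ≤ m ≤ n ≤ q+1` and real `a_m,…,a_n`, setting
`V(ν) = Σ_{k=m}^{n} a_k ψ_k(ν)` and `V₁(ν) = Σ_{k=m}^{n} (λ_1 - λ_k) a_k ψ_k(ν)`, one
has `N(V₁) ≥ N(V)`, `S⁻(V₁) ≥ S⁻(V)`, `S⁺(V₁) ≥ S⁺(V)`. -/
theorem stmt_16 (α β γ ρ : ℕ → ℝ) (P : ℕ → Polynomial ℝ)
    (hP : Recurrence α β γ ρ P)
    (q : ℕ) (η : ℝ) (Λ : ℕ → ℝ) (hΛ : SLZeros P q η Λ)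
    (m n : ℕ) (hm : 1 ≤ m) (hmn : m ≤ n) (hn : n ≤ q + 1)
    (a : ℕ → ℝ) (V V₁ : ℕ → ℝ)
    (hV : ∀ ν, V ν = ∑ k ∈ Finset.Icc m n, a k * (P ν).eval (Λ (k - 1)))
    (hV₁ : ∀ ν, V₁ ν = ∑ k ∈ Finset.Icc m n,
      (Λ 0 - Λ (k - 1)) * a k * (P ν).eval (Λ (k - 1))) :
    N q V₁ ≥ N q V ∧ Sminus q V₁ ≥ Sminus q V ∧ Splus q V₁ ≥ Splus q V := by
  have hψ := psi_pos hP hΛ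
  set w := wt β γ with hw
  have hwp : ∀ l, 0 < w l := wt_pos hP.hβ hP.hγ
  have hws : ∀ l, w (l + 1) * γ l = w l * β l := by
    intro l
    have := (hP.hγ l).ne'
    simp only [hw, wt]
    field_simp
  let ψ : ℕ → ℝ := fun l => (P l).eval (Λ 0)
  let k : ℕ → ℝ := fun l => if l ≤ q then w l * ρ l * ψ l else 1
  let p : ℕ → ℝ := fun l => w l * β l * ψ (l + 1)
  let r : ℕ → ℝ := fun l => w l * β l * ψ l
  have hk : ∀ l, 0 < k l := by
    intro l
    simp only [k]
    split_ifs with h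
    · exact mul_pos (mul_pos (hwp l) (hP.hρ l)) (hψ l h)
    · exact one_pos
  have hp : ∀ l < q, 0 < p l := fun l hl =>
    mul_pos (mul_pos (hwp l) (hP.hβ l)) (hψ (l + 1) hl)
  have hr : ∀ l < q, 0 < r l := fun l hl =>
    mul_pos (mul_pos (hwp l) (hP.hβ l)) (hψ l hl.le)
  -- recurrences for V
  have hVq : V (q + 1) = η * V q := by
    rw [hV, hV, Finset.mul_sum]
    refine Finset.sum_congr rfl fun j hj => ?_
    have hj' := Finset.mem_Icc.1 hj
    have h := hΛ.root (j - 1) (by omega)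
    simp only [Polynomial.eval_sub, Polynomial.eval_mul, Polynomial.eval_C] at h
    linear_combination a j * h
  have hψq : ψ (q + 1) = η * ψ q := by
    have h := hΛ.root 0 (by omega)
    simp only [Polynomial.eval_sub, Polynomial.eval_mul, Polynomial.eval_C] at h
    linear_combination h
  have hV0 : α 0 * V 0 + β 0 * V 1 = ρ 0 * (Λ 0 * V 0 - V₁ 0) := by
    rw [hV, hV, hV₁, Finset.mul_sum, Finset.mul_sum, Finset.mul_sum, ← Finset.sum_add_distrib,
      ← Finset.sum_sub_distrib, Finset.mul_sum]
    refine Finset.sum_congr rfl fun j hj => ?_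
    linear_combination a j * rec0 hP (Λ (j - 1))
  have hVS : ∀ l, γ l * V l + α (l + 1) * V (l + 1) + β (l + 1) * V (l + 2) =
      ρ (l + 1) * (Λ 0 * V (l + 1) - V₁ (l + 1)) := by
    intro l
    rw [hV, hV, hV, hV₁, Finset.mul_sum, Finset.mul_sum, Finset.mul_sum, Finset.mul_sum,
      ← Finset.sum_add_distrib, ← Finset.sum_add_distrib,
      ← Finset.sum_sub_distrib, Finset.mul_sum]
    refine Finset.sum_congr rfl fun j hj => ?_
    linear_combination a j * recS hP l (Λ (j - 1))
  have hψ0 : α 0 * ψ 0 + β 0 * ψ 1 = Λ 0 * (ρ 0 * ψ 0) := rec0 hP (Λ 0)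
  have hψS : ∀ l, γ l * ψ l + α (l + 1) * ψ (l + 1) + β (l + 1) * ψ (l + 2) =
      Λ 0 * (ρ (l + 1) * ψ (l + 1)) := fun l => recS hP l (Λ 0)
  have hD : ∀ l ≤ q, Dd p r q V l = w l * β l * (ψ (l + 1) * V l - ψ l * V (l + 1)) := by
    intro l hl
    unfold Dd
    split_ifs with h
    · simp only [p, r]; ring
    · obtain rfl : l = q := by omega
      rw [hVq, hψq]; ring
  have hL : ∀ l ≤ q, Ld k p r q V l = V₁ l := by
    intro l hl
    cases l with
    | zero =>
      have hk0 := hk 0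
      simp only [Ld]
      rw [div_eq_iff hk0.ne', hD 0 hl]
      simp only [k, hl, if_true, zero_add]
      linear_combination w 0 * V 0 * hψ0 - w 0 * ψ 0 * hV0
    | succ l =>
      simp only [Ld]
      rw [div_eq_iff (hk _).ne', hD _ hl, hD l (by omega)]
      simp only [k, hl, if_true]
      linear_combination w (l + 1) * V (l + 1) * hψS l - w (l + 1) * ψ (l + 1) * hVS l -
        (V (l + 1) * ψ l - V l * ψ (l + 1)) * hws l
  have eA : ∀ g, Admissible q (Ld k p r q V) g ↔ Admissible q V₁ g := by
    intro g
    unfold Admissible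
    refine and_congr_right fun _ => forall₂_congr fun l hl => ?_
    rw [hL l hl]
  have eN : N q (Ld k p r q V) = N q V₁ := by
    unfold N
    congr 1
    ext ν
    simp only [Set.mem_ofPred_eq, IsZero]
    refine or_congr (and_congr_right fun h => by rw [hL ν h])
      (and_congr_right fun h1 => and_congr_right fun h => by rw [hL ν h, hL (ν - 1) (by omega)])
  have h1 := N_op hk hp hr V
  have h2 := Sminus_op hk hp hr V
  have h3 := Splus_op hk hp hr V
  rw [eN] at h1
  have e2 : Sminus q (Ld k p r q V) = Sminus q V₁ := by
    unfold Sminus; simp only [eA]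
  have e3 : Splus q (Ld k p r q V) = Splus q V₁ := by
    unfold Splus; simp only [eA]
  rw [e2] at h2
  rw [e3] at h3
  exact ⟨h1, h2, h3⟩

end DiscPaper
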